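/- There is a bijection between W_* and the product of the set of k-tuples (p_1, …, p_k) of nonnegative integers summing to n with the set of (k+1)-tuples (q_0, …, q_k) of nonnegative integers summing to n − k − 1, given by sending w to its sequences of p- and q-statistics. -/

import Mathlib

inductive Letter : Type
  | R | U | D
deriving DecidableEq

/-- The lengths of the blocks into which the letters `U` cut a word. -/
def blockLengths (w : List Letter) : List ℕ := (w.splitOn Letter.U).map List.length

/-- The numbers of letters `D` in the blocks into which the letters `R` cut a word. -/
def blockCounts (w : List Letter) : List ℕ := (w.splitOn Letter.R).map (fun s => s.count Letter.D)

theorem List.splitOn_eq_cons {α : Type*} [BEq α] (a : α) (l : List α) :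
    ∃ b t, l.splitOn a = b :: t :=
  List.exists_cons_of_ne_nil (List.splitOnP_ne_nil _ _)

theorem blockLengths_nil : blockLengths [] = [0] := by
  simp [blockLengths]

theorem blockCounts_nil : blockCounts [] = [0] := by
  simp [blockCounts]

theorem blockLengths_eq_cons (w : List Letter) : ∃ b t, blockLengths w = b :: t := by
  obtain ⟨b, t, h⟩ := List.splitOn_eq_cons Letter.U w
  simp [blockLengths, h]

theorem blockCounts_eq_cons (w : List Letter) : ∃ b t, blockCounts w = b :: t := by
  obtain ⟨b, t, h⟩ := List.splitOn_eq_cons Letter.R w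
  simp [blockCounts, h]

theorem blockLengths_cons_U (w : List Letter) :
    blockLengths (Letter.U :: w) = 0 :: blockLengths w := by
  simp [blockLengths, List.splitOn_cons_eq_if_modifyHead]

theorem blockLengths_cons_of_ne {x : Letter} (hx : x ≠ Letter.U) (w : List Letter) :
    blockLengths (x :: w) = (blockLengths w).modifyHead (· + 1) := by
  obtain ⟨b, t, h⟩ := List.splitOn_eq_cons Letter.U w
  simp [blockLengths, List.splitOn_cons_eq_if_modifyHead, h, hx]

theorem blockCounts_cons_R (w : List Letter) :
    blockCounts (Letter.R :: w) = 0 :: blockCounts w := by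
  simp [blockCounts, List.splitOn_cons_eq_if_modifyHead]

theorem blockCounts_cons_U (w : List Letter) :
    blockCounts (Letter.U :: w) = blockCounts w := by
  obtain ⟨b, t, h⟩ := List.splitOn_eq_cons Letter.R w
  simp [blockCounts, List.splitOn_cons_eq_if_modifyHead, h]

theorem blockCounts_cons_D (w : List Letter) :
    blockCounts (Letter.D :: w) = (blockCounts w).modifyHead (· + 1) := by
  obtain ⟨b, t, h⟩ := List.splitOn_eq_cons Letter.R w
  simp [blockCounts, List.splitOn_cons_eq_if_modifyHead, h]

theorem length_blockLengths (w : List Letter) :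
    (blockLengths w).length = w.count Letter.U + 1 := by
  induction w with
  | nil => simp [blockLengths_nil]
  | cons x w ih =>
    cases x <;> simp [blockLengths_cons_U, blockLengths_cons_of_ne, ih]

theorem sum_blockLengths (w : List Letter) :
    (blockLengths w).sum = w.count Letter.R + w.count Letter.D := by
  induction w with
  | nil => simp [blockLengths_nil]
  | cons x w ih =>
    obtain ⟨b, t, h⟩ := blockLengths_eq_cons w
    rw [h, List.sum_cons] at ih
    cases x <;> simp [blockLengths_cons_U, blockLengths_cons_of_ne, h] <;> omega

theorem length_blockCounts (w : List Letter) :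
    (blockCounts w).length = w.count Letter.R + 1 := by
  induction w with
  | nil => simp [blockCounts_nil]
  | cons x w ih =>
    cases x <;> simp [blockCounts_cons_U, blockCounts_cons_R, blockCounts_cons_D, ih]

theorem sum_blockCounts (w : List Letter) :
    (blockCounts w).sum = w.count Letter.D := by
  induction w with
  | nil => simp [blockCounts_nil]
  | cons x w ih =>
    obtain ⟨b, t, h⟩ := blockCounts_eq_cons w
    rw [h, List.sum_cons] at ih
    cases x <;> simp [blockCounts_cons_U, blockCounts_cons_R, blockCounts_cons_D, h] <;> omega

/-- A word is determined by its block lengths and its block counts. -/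
theorem eq_of_blockLengths_eq_of_blockCounts_eq {v w : List Letter}
    (hl : blockLengths v = blockLengths w) (hc : blockCounts v = blockCounts w) : v = w := by
  induction v generalizing w with
  | nil =>
    have h1 := length_blockLengths w
    have h2 := sum_blockLengths w
    simp only [← hl, blockLengths_nil, List.length_singleton, List.sum_singleton] at h1 h2
    rcases w with _ | ⟨x, w⟩
    · rfl
    · cases x <;> simp at h1 h2
      omega
  | cons x v ih =>
    obtain ⟨a, s, ha⟩ := blockLengths_eq_cons v
    obtain ⟨c, u, hv⟩ := blockCounts_eq_cons v
    rcases w with _ | ⟨y, w⟩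
    · cases x <;> simp [blockLengths_cons_U, blockLengths_cons_of_ne, blockLengths_nil, ha] at hl
    · obtain ⟨b, t, hb⟩ := blockLengths_eq_cons w
      obtain ⟨d, z, hw⟩ := blockCounts_eq_cons w
      have key : x = y ∧ blockLengths v = blockLengths w ∧ blockCounts v = blockCounts w := by
        cases x <;> cases y <;>
          simp_all [blockLengths_cons_U, blockLengths_cons_of_ne, blockCounts_cons_U,
            blockCounts_cons_R, blockCounts_cons_D]
      rw [key.1, ih key.2.1 key.2.2]

/-- Block lengths and block counts can be prescribed, provided that both yield the same number of
letters other than `U`. -/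
theorem exists_blockLengths_eq_blockCounts_eq (a : ℕ) (s : List ℕ) (c : ℕ) (u : List ℕ)
    (h : a + s.sum = u.length + (c + u.sum)) :
    ∃ w, blockLengths w = a :: s ∧ blockCounts w = c :: u := by
  match a, s, c, u with
  | 0, [], c, u =>
    have hu : u = [] := List.eq_nil_of_length_eq_zero (by simp at h; omega)
    have hc : c = 0 := by simp at h; omega
    exact ⟨[], by simp [blockLengths_nil, blockCounts_nil, hu, hc]⟩
  | 0, a :: s, c, u =>
    obtain ⟨w, h1, h2⟩ := exists_blockLengths_eq_blockCounts_eq a s c u (by simp at h; omega)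
    exact ⟨Letter.U :: w, by rw [blockLengths_cons_U, h1], by rw [blockCounts_cons_U, h2]⟩
  | a + 1, s, 0, [] => simp at h
  | a + 1, s, 0, c :: u =>
    obtain ⟨w, h1, h2⟩ := exists_blockLengths_eq_blockCounts_eq a s c u (by simp at h; omega)
    exact ⟨Letter.R :: w, by simp [blockLengths_cons_of_ne, h1], by rw [blockCounts_cons_R, h2]⟩
  | a + 1, s, c + 1, u =>
    obtain ⟨w, h1, h2⟩ := exists_blockLengths_eq_blockCounts_eq a s c u (by omega)
    exact ⟨Letter.D :: w, by simp [blockLengths_cons_of_ne, h1], by simp [blockCounts_cons_D, h2]⟩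
termination_by a + s.sum + s.length

theorem exists_D_before_R_iff (w : List Letter) :
    (∃ u v : List Letter, w = u ++ Letter.D :: v ∧ Letter.R ∉ u) ↔
      0 < (blockCounts w).getD 0 0 := by
  induction w with
  | nil => simp [blockCounts_nil]
  | cons x w ih =>
    obtain ⟨b, t, h⟩ := blockCounts_eq_cons w
    cases x
    · simp [blockCounts_cons_R, List.cons_eq_append_iff]
    · rw [blockCounts_cons_U, ← ih]
      constructor
      · rintro ⟨_ | ⟨y, u⟩, v, h, hu⟩
        · simp at h
        · simp at h hu
          exact ⟨u, v, h.2, hu.2⟩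
      · rintro ⟨u, v, rfl, hu⟩
        exact ⟨Letter.U :: u, v, by simp, by simpa using hu⟩
    · simp only [blockCounts_cons_D, h]
      simp
      exact ⟨[], ⟨w, rfl⟩, by simp⟩

theorem blockLengths_eq_zero_cons {w : List Letter} (hD : w.head? ≠ some Letter.D)
    (hR : 0 < (blockCounts w).getD 0 0) : ∃ t, blockLengths w = 0 :: t := by
  rcases w with _ | ⟨x, w⟩
  · simp [blockLengths_nil]
  · cases x <;> simp_all [blockLengths_cons_U, blockCounts_cons_R]

theorem head?_ne_of_blockLengths_eq_zero_cons {w : List Letter} {t : List ℕ}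
    (h : blockLengths w = 0 :: t) : w.head? ≠ some Letter.D := by
  rcases w with _ | ⟨x, w⟩
  · simp
  · obtain ⟨b, s, hb⟩ := blockLengths_eq_cons w
    cases x <;> simp_all [blockLengths_cons_of_ne]

theorem List.sum_getD_eq_sum {m : ℕ} {l : List ℕ} (h : l.length = m) :
    ∑ i : Fin m, l.getD i.val 0 = l.sum := by
  subst h
  simp

theorem List.eq_of_forall_getD_eq {m : ℕ} {l l' : List ℕ} (h : l.length = m) (h' : l'.length = m)
    (H : ∀ i : Fin m, l.getD i.val 0 = l'.getD i.val 0) : l = l' := by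
  refine List.ext_getElem (h.trans h'.symm) fun i h1 h2 => ?_
  simpa [h1, h2] using H ⟨i, h ▸ h1⟩

open Letter in
/-- The map sending a word `w ∈ W_*` to its sequences of `p`- and `q`-statistics is a
bijection from `W_*` onto the product of the set of `k`-tuples `(p_1, …, p_k)` of
nonnegative integers summing to `n` with the set of `(k+1)`-tuples `(q_0, …, q_k)` of
nonnegative integers summing to `n - k - 1`. -/
theorem stmt_9 (n k : ℕ) (hk : 1 ≤ k) (hkn : k ≤ n) :
    Set.BijOn
      (fun w : List Letter =>
        ((fun i : Fin k => ((w.splitOn U).map List.length).getD (i.val + 1) 0,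
          fun i : Fin (k + 1) =>
            if i.val = 0 then ((w.splitOn R).map (fun s => s.count D)).getD 0 0 - 1
            else ((w.splitOn R).map (fun s => s.count D)).getD i.val 0) :
          (Fin k → ℕ) × (Fin (k + 1) → ℕ)))
      {w : List Letter |
        w.count R = k ∧ w.count U = k ∧ w.count D = n - k ∧
        w.head? ≠ some D ∧ (∃ u v : List Letter, w = u ++ D :: v ∧ R ∉ u)}
      {pq : (Fin k → ℕ) × (Fin (k + 1) → ℕ) |
        (∑ i, pq.1 i) = n ∧ (∑ i, (pq.2 i : ℤ)) = (n : ℤ) - k - 1} := by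
  change Set.BijOn
      (fun w : List Letter =>
        ((fun i : Fin k => (blockLengths w).getD (i.val + 1) 0,
          fun i : Fin (k + 1) =>
            if i.val = 0 then (blockCounts w).getD 0 0 - 1
            else (blockCounts w).getD i.val 0) :
          (Fin k → ℕ) × (Fin (k + 1) → ℕ))) _ _
  refine ⟨?_, ?_, ?_⟩
  · rintro w ⟨hR, hU, hD, hhead, hDR⟩
    rw [exists_D_before_R_iff] at hDR
    obtain ⟨t, ht⟩ := blockLengths_eq_zero_cons hhead hDR
    obtain ⟨b, s, hs⟩ := blockCounts_eq_cons w
    have h1 := length_blockLengths w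
    have h2 := sum_blockLengths w
    have h3 := length_blockCounts w
    have h4 := sum_blockCounts w
    simp only [ht, hs, List.length_cons, List.sum_cons, List.getD_cons_zero] at h1 h2 h3 h4 hDR
    refine ⟨?_, ?_⟩
    · simp only [ht, List.getD_cons_succ]
      rw [List.sum_getD_eq_sum (by omega)]
      omega
    · simp only [hs]
      rw [Fin.sum_univ_succ]
      simp only [Fin.val_zero, if_true, Fin.val_succ, Nat.succ_ne_zero, if_false,
        List.getD_cons_zero, List.getD_cons_succ]
      rw [← Nat.cast_sum, List.sum_getD_eq_sum (by omega)]
      omega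
  · rintro v ⟨hR, hU, -, hhead, hDR⟩ w ⟨hR', hU', -, hhead', hDR'⟩ h
    rw [exists_D_before_R_iff] at hDR hDR'
    obtain ⟨t, ht⟩ := blockLengths_eq_zero_cons hhead hDR
    obtain ⟨t', ht'⟩ := blockLengths_eq_zero_cons hhead' hDR'
    simp only [Prod.mk.injEq, funext_iff] at h
    apply eq_of_blockLengths_eq_of_blockCounts_eq
    · refine List.eq_of_forall_getD_eq (m := k + 1) (by rw [length_blockLengths, hU])
        (by rw [length_blockLengths, hU']) (Fin.cases ?_ h.1)
      simp [ht, ht']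
    · refine List.eq_of_forall_getD_eq (m := k + 1) (by rw [length_blockCounts, hR])
        (by rw [length_blockCounts, hR']) fun i => ?_
      have hi := h.2 i
      split_ifs at hi with h0
      · rw [h0]
        omega
      · exact hi
  · rintro ⟨p, q⟩ ⟨hp, hq⟩
    simp only at hp hq
    rw [Fin.sum_univ_succ, ← Nat.cast_sum] at hq
    obtain ⟨w, hl, hc⟩ := exists_blockLengths_eq_blockCounts_eq 0 (List.ofFn p) (q 0 + 1)
      (List.ofFn fun i => q i.succ) (by simp only [List.sum_ofFn, List.length_ofFn]; omega)
    have h1 := length_blockLengths w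
    have h3 := length_blockCounts w
    have h4 := sum_blockCounts w
    simp only [hl, hc, List.length_cons, List.length_ofFn, List.sum_cons, List.sum_ofFn]
      at h1 h3 h4
    refine ⟨w, ⟨by omega, by omega, by omega, head?_ne_of_blockLengths_eq_zero_cons hl, ?_⟩, ?_⟩
    · rw [exists_D_before_R_iff, hc]
      simp
    · simp only [hl, hc, Prod.mk.injEq]
      refine ⟨funext fun i => by simp, funext (Fin.cases (by simp) fun i => by simp)⟩
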